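/- arXiv:2511.13787 — 6 statements merged into one kernel-verified Lean document; each statement's English description precedes it below -/
import Mathlib

section
/- If c ∈ [0, 1] with c ≠ 1/2 and μ_j ≠ 0, then for every f_i ∈ ℝ^{d_i} the function f_j ↦ Q(1, f_i, f_j) is not constant on ℝ^{d_j}: there exist f_j, f_j' ∈ ℝ^{d_j} with Q(1, f_i, f_j) ≠ Q(1, f_i, f_j'). (That is, the Bayes-optimal model for task i places nonzero weight on the task-j generative factor.) -/
open Real Filter

/-- Unnormalized Gaussian class-conditional density
`φ(f, y, μ, σ) = exp(−‖f − y·μ‖²/(2σ²))`. -/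
noncomputable def phi {d : ℕ} (f : EuclideanSpace ℝ (Fin d)) (y : ℝ)
    (μ : EuclideanSpace ℝ (Fin d)) (σ : ℝ) : ℝ :=
  Real.exp (-‖f - y • μ‖ ^ 2 / (2 * σ ^ 2))

/-- Unnormalized joint density of the two-task generative model. -/
noncomputable def g {di dj : ℕ} (μi : EuclideanSpace ℝ (Fin di))
    (μj : EuclideanSpace ℝ (Fin dj)) (σi σj c y : ℝ)
    (fi : EuclideanSpace ℝ (Fin di)) (fj : EuclideanSpace ℝ (Fin dj)) : ℝ :=
  (1 / 2) * phi fi y μi σi *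
    (c * phi fj y μj σj + (1 - c) * phi fj (-y) μj σj)

/-- Bayes posterior of task `i`. -/
noncomputable def Q {di dj : ℕ} (μi : EuclideanSpace ℝ (Fin di))
    (μj : EuclideanSpace ℝ (Fin dj)) (σi σj c y : ℝ)
    (fi : EuclideanSpace ℝ (Fin di)) (fj : EuclideanSpace ℝ (Fin dj)) : ℝ :=
  g μi μj σi σj c y fi fj /
    (g μi μj σi σj c 1 fi fj + g μi μj σi σj c (-1) fi fj)

theorem phi_pos {d : ℕ} (f : EuclideanSpace ℝ (Fin d)) (y : ℝ)
    (μ : EuclideanSpace ℝ (Fin d)) (σ : ℝ) : 0 < phi f y μ σ :=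
  Real.exp_pos _

theorem phi_neg_neg {d : ℕ} (f : EuclideanSpace ℝ (Fin d)) (y : ℝ)
    (μ : EuclideanSpace ℝ (Fin d)) (σ : ℝ) : phi (-f) (-y) μ σ = phi f y μ σ := by
  have h : -f - (-y) • μ = -(f - y • μ) := by rw [neg_smul]; abel
  rw [phi, phi, h, norm_neg]

theorem phi_self_one {d : ℕ} (μ : EuclideanSpace ℝ (Fin d)) (σ : ℝ) : phi μ 1 μ σ = 1 := by
  simp [phi]

theorem phi_self_neg_one_lt_one {d : ℕ} {μ : EuclideanSpace ℝ (Fin d)} (hμ : μ ≠ 0)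
    {σ : ℝ} (hσ : 0 < σ) : phi μ (-1) μ σ < 1 := by
  have h : μ - (-1 : ℝ) • μ = (2 : ℝ) • μ := by module
  have hpos : 0 < ‖(2 : ℝ) • μ‖ := norm_pos_iff.mpr (smul_ne_zero two_ne_zero hμ)
  rw [phi, h, Real.exp_lt_one_iff, neg_div, neg_lt_zero]
  positivity

/-- Exchanging two distinct positive likelihoods changes a two-class posterior. -/
theorem posterior_ne_of_swap {a b u v : ℝ} (ha : 0 < a) (hb : 0 < b) (hu : 0 < u)
    (hv : 0 < v) (huv : u ≠ v) :
    a * u / (a * u + b * v) ≠ a * v / (a * v + b * u) := by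
  intro h
  rw [div_eq_div_iff (by positivity) (by positivity)] at h
  have key : a * b * (u + v) * (u - v) = 0 := by linear_combination h
  exact mul_ne_zero (by positivity) (sub_ne_zero.mpr huv) key

theorem stmt_6 {di dj : ℕ} (hdi : 1 ≤ di) (hdj : 1 ≤ dj)
    (μi : EuclideanSpace ℝ (Fin di)) (μj : EuclideanSpace ℝ (Fin dj))
    (σi σj : ℝ) (hσi : 0 < σi) (hσj : 0 < σj)
    (c : ℝ) (hc : c ∈ Set.Icc (0 : ℝ) 1) (hc' : c ≠ 1 / 2) (hμj : μj ≠ 0)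
    (fi : EuclideanSpace ℝ (Fin di)) :
    ∃ fj fj' : EuclideanSpace ℝ (Fin dj),
      Q μi μj σi σj c 1 fi fj ≠ Q μi μj σi σj c 1 fi fj' := by
  obtain ⟨hc0, hc1⟩ := hc
  have hq0 : 0 < phi μj (-1) μj σj := phi_pos _ _ _ _
  have hq1 : phi μj (-1) μj σj < 1 := phi_self_neg_one_lt_one hμj hσj
  have hneg : phi (-μj) 1 μj σj = phi μj (-1) μj σj := by
    simpa using phi_neg_neg μj (-1) μj σj
  have hneg' : phi (-μj) (-1) μj σj = 1 := by
    rw [phi_neg_neg, phi_self_one]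
  refine ⟨μj, -μj, ?_⟩
  simp only [Q, g, neg_neg, hneg, hneg', phi_self_one]
  generalize phi μj (-1) μj σj = q at *
  have ha := phi_pos fi 1 μi σi
  have hb := phi_pos fi (-1) μi σi
  have hu : 0 < c * 1 + (1 - c) * q := by nlinarith
  have hv : 0 < c * q + (1 - c) * 1 := by nlinarith
  have huv : c * 1 + (1 - c) * q ≠ c * q + (1 - c) * 1 := by
    intro h
    have key : (c - 1 / 2) * (1 - q) = 0 := by linear_combination h / 2
    exact mul_ne_zero (sub_ne_zero.mpr hc') (sub_pos.mpr hq1).ne' key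
  exact posterior_ne_of_swap (by positivity) (by positivity) hu hv huv
end

section
/- For every c ∈ [0, 1] and every f_i ∈ ℝ^{d_i}, the function t ↦ log(Q(1, f_i, t·μ_j)/Q(−1, f_i, t·μ_j)) (the posterior log-odds along the direction μ_j) is differentiable at t = 0 with derivative equal to 2(2c − 1)·‖μ_j‖²/σ_j². -/
open Real Filter

theorem phi_smul {d : ℕ} (t y : ℝ) (μ : EuclideanSpace ℝ (Fin d)) (σ : ℝ) :
    phi (t • μ) y μ σ = Real.exp (-((t - y) ^ 2 * ‖μ‖ ^ 2) / (2 * σ ^ 2)) := by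
  rw [phi, ← sub_smul, norm_smul, mul_pow, Real.norm_eq_abs, sq_abs]

theorem hasDerivAt_phi_smul {d : ℕ} (t y : ℝ) (μ : EuclideanSpace ℝ (Fin d)) (σ : ℝ) :
    HasDerivAt (fun s : ℝ => phi (s • μ) y μ σ)
      (phi (t • μ) y μ σ * (-(2 * (t - y) * ‖μ‖ ^ 2) / (2 * σ ^ 2))) t := by
  simp only [phi_smul]
  have h := (((((hasDerivAt_id t).sub_const y).pow 2).mul_const (‖μ‖ ^ 2)).neg.div_const
    (2 * σ ^ 2)).exp
  simpa using h

theorem mixture_pos {c a b : ℝ} (hc : c ∈ Set.Icc (0 : ℝ) 1) (ha : 0 < a) (hb : 0 < b) :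
    0 < c * a + (1 - c) * b := by
  obtain ⟨h0, h1⟩ := hc
  rcases h0.eq_or_lt with rfl | h
  · simpa using hb
  · exact add_pos_of_pos_of_nonneg (mul_pos h ha) (mul_nonneg (sub_nonneg.2 h1) hb.le)

theorem g_pos {di dj : ℕ} (μi : EuclideanSpace ℝ (Fin di))
    (μj : EuclideanSpace ℝ (Fin dj)) (σi σj : ℝ) {c : ℝ} (hc : c ∈ Set.Icc (0 : ℝ) 1) (y : ℝ)
    (fi : EuclideanSpace ℝ (Fin di)) (fj : EuclideanSpace ℝ (Fin dj)) :
    0 < g μi μj σi σj c y fi fj :=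
  mul_pos (mul_pos one_half_pos (phi_pos ..)) (mixture_pos hc (phi_pos ..) (phi_pos ..))

theorem hasDerivAt_log_g_smul_zero {di dj : ℕ} (μi : EuclideanSpace ℝ (Fin di))
    (μj : EuclideanSpace ℝ (Fin dj)) (σi σj : ℝ) {c : ℝ} (hc : c ∈ Set.Icc (0 : ℝ) 1) (y : ℝ)
    (fi : EuclideanSpace ℝ (Fin di)) :
    HasDerivAt (fun t : ℝ => Real.log (g μi μj σi σj c y fi (t • μj)))
      ((2 * c - 1) * y * ‖μj‖ ^ 2 / σj ^ 2) 0 := by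
  have h := ((((hasDerivAt_phi_smul 0 y μj σj).const_mul c).add
    ((hasDerivAt_phi_smul 0 (-y) μj σj).const_mul (1 - c))).const_mul
      ((1 / 2) * phi fi y μi σi)).log (g_pos μi μj σi σj hc y fi ((0 : ℝ) • μj)).ne'
  refine h.congr_deriv ?_
  have hsymm : phi ((0 : ℝ) • μj) (-y) μj σj = phi ((0 : ℝ) • μj) y μj σj := by
    rw [phi_smul, phi_smul, zero_sub, zero_sub, neg_neg, neg_sq]
  have hi := (phi_pos fi y μi σi).ne'
  have hj := (phi_pos ((0 : ℝ) • μj) y μj σj).ne'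
  simp only [Pi.add_apply, hsymm]
  rw [← add_mul, add_sub_cancel, one_mul]
  field_simp
  ring

theorem stmt_7 {di dj : ℕ} (hdi : 1 ≤ di) (hdj : 1 ≤ dj)
    (μi : EuclideanSpace ℝ (Fin di)) (μj : EuclideanSpace ℝ (Fin dj))
    (σi σj : ℝ) (hσi : 0 < σi) (hσj : 0 < σj)
    (c : ℝ) (hc : c ∈ Set.Icc (0 : ℝ) 1)
    (fi : EuclideanSpace ℝ (Fin di)) :
    HasDerivAt
      (fun t : ℝ =>
        Real.log (Q μi μj σi σj c 1 fi (t • μj) / Q μi μj σi σj c (-1) fi (t • μj)))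
      (2 * (2 * c - 1) * ‖μj‖ ^ 2 / σj ^ 2) 0 := by
  have hg := fun (y t : ℝ) => g_pos μi μj σi σj hc y fi (t • μj)
  have h := (hasDerivAt_log_g_smul_zero μi μj σi σj hc 1 fi).sub
    (hasDerivAt_log_g_smul_zero μi μj σi σj hc (-1) fi)
  refine (h.congr_deriv (by ring)).congr_of_eventuallyEq (.of_forall fun t => ?_)
  simp only [Q, Pi.sub_apply]
  rw [div_div_div_cancel_right₀ (add_pos (hg 1 t) (hg (-1) t)).ne',
    Real.log_div (hg 1 t).ne' (hg (-1) t).ne']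
end

section
/- For c ∈ [0, 1]: if c > 1/2 then h_c is strictly increasing on ℝ; if c < 1/2 then h_c is strictly decreasing on ℝ; and if c = 1/2 then h_c is identically 0 on ℝ. -/
open Real Filter

/-- `h_c(u) = log(c·e^u + (1 − c)·e^{−u}) − log(c·e^{−u} + (1 − c)·e^u)`. -/
noncomputable def h (c u : ℝ) : ℝ :=
  Real.log (c * Real.exp u + (1 - c) * Real.exp (-u)) -
    Real.log (c * Real.exp (-u) + (1 - c) * Real.exp u)

theorem convexComb_exp_pos {c : ℝ} (hc : c ∈ Set.Icc (0 : ℝ) 1) (u v : ℝ) :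
    0 < c * Real.exp u + (1 - c) * Real.exp v := by
  obtain ⟨h0, h1⟩ := hc
  have hu := Real.exp_pos u
  have hv := Real.exp_pos v
  rcases h0.eq_or_lt with rfl | h0
  · simpa using hv
  · have := mul_pos h0 hu
    have := mul_nonneg (sub_nonneg.2 h1) hv.le
    linarith

theorem h_one_sub (c u : ℝ) : h (1 - c) u = -h c u := by
  simp only [h, sub_sub_cancel, neg_sub]
  rw [add_comm ((1 - c) * Real.exp u), add_comm ((1 - c) * Real.exp (-u))]

theorem h_strictMono {c : ℝ} (hc : c ∈ Set.Icc (0 : ℝ) 1) (hc' : 1 / 2 < c) :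
    StrictMono (h c) := by
  intro u v huv
  have hPu := convexComb_exp_pos hc u (-u)
  have hQu := convexComb_exp_pos hc (-u) u
  have hPv := convexComb_exp_pos hc v (-v)
  have hQv := convexComb_exp_pos hc (-v) v
  have hexp : Real.exp u * Real.exp (-v) < Real.exp v * Real.exp (-u) := by
    rw [← Real.exp_add, ← Real.exp_add, Real.exp_lt_exp]
    linarith
  have hlog := Real.log_lt_log (mul_pos hPu hQv)
    (show _ < (c * Real.exp v + (1 - c) * Real.exp (-v)) *
        (c * Real.exp (-u) + (1 - c) * Real.exp u) by
      linear_combination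
        mul_pos (show 0 < 2 * c - 1 by linarith) (sub_pos.2 hexp))
  rw [Real.log_mul hPu.ne' hQv.ne', Real.log_mul hPv.ne' hQu.ne'] at hlog
  unfold h
  linarith

theorem stmt_9 (c : ℝ) (hc : c ∈ Set.Icc (0 : ℝ) 1) :
    (1 / 2 < c → StrictMono (h c)) ∧
      (c < 1 / 2 → StrictAnti (h c)) ∧
      (c = 1 / 2 → ∀ u : ℝ, h c u = 0) := by
  refine ⟨h_strictMono hc, fun hlt u v huv => ?_, ?_⟩
  · have hc' : 1 - c ∈ Set.Icc (0 : ℝ) 1 := ⟨sub_nonneg.2 hc.2, sub_le_self 1 hc.1⟩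
    have hmono := h_strictMono hc' (by linarith) huv
    rw [h_one_sub, h_one_sub] at hmono
    exact neg_lt_neg_iff.1 hmono
  · rintro rfl u
    have hsymm := h_one_sub (1 / 2) u
    norm_num at hsymm ⊢
    linarith
end

section
/- For every c ∈ (0, 1) with c ≠ 1/2 and every u ∈ ℝ, the strict bound |h_c(u)| < |log(c/(1 − c))| holds. -/
open Real Filter

/-- The logarithms of the two swapped positive combinations of `x` and `y` differ by less than the
logarithms of the weights. -/
theorem abs_log_sub_log_swap_lt {a b x y : ℝ} (hb : 0 < b) (hab : b < a) (hx : 0 < x)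
    (hy : 0 < y) :
    |Real.log (a * x + b * y) - Real.log (a * y + b * x)| < Real.log a - Real.log b := by
  have ha : 0 < a := hb.trans hab
  have hsq : b * b < a * a := mul_self_lt_mul_self hb.le hab
  have key : ∀ s t : ℝ, 0 < s → 0 < t →
      Real.log (a * s + b * t) + Real.log b < Real.log (a * t + b * s) + Real.log a := by
    intro s t hs ht
    have h₁ : 0 < a * s + b * t := by positivity
    have h₂ : 0 < a * t + b * s := by positivity
    rw [← Real.log_mul h₁.ne' hb.ne', ← Real.log_mul h₂.ne' ha.ne']
    apply Real.log_lt_log (mul_pos h₁ hb)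
    linarith [mul_lt_mul_of_pos_right hsq ht]
  rw [abs_lt]
  constructor <;> linarith [key x y hx hy, key y x hy hx]

theorem stmt_12 (c : ℝ) (hc : c ∈ Set.Ioo (0 : ℝ) 1) (hc' : c ≠ 1 / 2) (u : ℝ) :
    |h c u| < |Real.log (c / (1 - c))| := by
  obtain ⟨h0, h1⟩ := hc
  have hd : 0 < 1 - c := sub_pos.2 h1
  rw [Real.log_div h0.ne' hd.ne', h]
  rcases lt_or_gt_of_ne hc' with hlt | hgt
  · have := abs_log_sub_log_swap_lt h0 (by linarith : c < 1 - c) (Real.exp_pos (-u))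
      (Real.exp_pos u)
    rw [add_comm (c * _), add_comm (c * _), abs_sub_comm (Real.log c)]
    exact this.trans_le (le_abs_self _)
  · exact (abs_log_sub_log_swap_lt hd (by linarith : 1 - c < c) (Real.exp_pos u)
      (Real.exp_pos (-u))).trans_le (le_abs_self _)
end

section
/- For every c ∈ (1/2, 1), the function h_c is a strictly increasing bijection from ℝ onto the open interval (−log(c/(1 − c)), log(c/(1 − c))). -/
open Real Filter

theorem h_eq_log {c : ℝ} (hc : c ∈ Set.Ioo (0 : ℝ) 1) (u : ℝ) :
    h c u = Real.log ((c * Real.exp (2 * u) + (1 - c)) / (c + (1 - c) * Real.exp (2 * u))) := by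
  have h₀ : 0 < c := hc.1
  have h₁ : 0 < 1 - c := sub_pos.2 hc.2
  rw [h, ← Real.log_div (by positivity) (by positivity), Real.exp_neg, two_mul, Real.exp_add]
  congr 1
  field_simp

theorem strictMono_h {c : ℝ} (hc : c ∈ Set.Ioo (1 / 2 : ℝ) 1) : StrictMono (h c) := by
  obtain ⟨h_half, h_one⟩ := hc
  have h₀ : 0 < c := by linarith
  have h₁ : 0 < 1 - c := by linarith
  intro u v huv
  have hexp : Real.exp (2 * u) < Real.exp (2 * v) := Real.exp_lt_exp.2 (by linarith)
  rw [h_eq_log ⟨h₀, h_one⟩, h_eq_log ⟨h₀, h_one⟩]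
  refine Real.log_lt_log (by positivity) ?_
  rw [div_lt_div_iff₀ (by positivity) (by positivity)]
  nlinarith [mul_pos (sub_pos.2 h_half) (sub_pos.2 hexp)]

theorem range_h {c : ℝ} (hc : c ∈ Set.Ioo (1 / 2 : ℝ) 1) :
    Set.range (h c) = Set.Ioo (-Real.log (c / (1 - c))) (Real.log (c / (1 - c))) := by
  obtain ⟨h_half, h_one⟩ := hc
  have h₀ : 0 < c := by linarith
  have h₁ : 0 < 1 - c := by linarith
  rw [← Real.log_inv, inv_div]
  ext w
  constructor
  · rintro ⟨u, rfl⟩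
    rw [h_eq_log ⟨h₀, h_one⟩]
    constructor <;> refine Real.log_lt_log (by positivity) ?_ <;>
      rw [div_lt_div_iff₀ (by positivity) (by positivity)]
    · nlinarith [mul_pos (sub_pos.2 h_half) (Real.exp_pos (2 * u))]
    · nlinarith
  · rintro ⟨hl, hr⟩
    rw [Real.log_lt_iff_lt_exp (by positivity), div_lt_iff₀ h₀] at hl
    rw [Real.lt_log_iff_exp_lt (by positivity), lt_div_iff₀ h₁] at hr
    have hnum : 0 < c * Real.exp w - (1 - c) := by linarith
    have hden : 0 < c - (1 - c) * Real.exp w := by linarith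
    refine ⟨Real.log ((c * Real.exp w - (1 - c)) / (c - (1 - c) * Real.exp w)) / 2, ?_⟩
    rw [h_eq_log ⟨h₀, h_one⟩, mul_div_cancel₀ _ two_ne_zero, Real.exp_log (by positivity)]
    conv_rhs => rw [← Real.log_exp w]
    congr 1
    rw [div_eq_iff (by positivity)]
    field_simp
    ring

theorem stmt_13 (c : ℝ) (hc : c ∈ Set.Ioo (1 / 2 : ℝ) 1) :
    StrictMono (h c) ∧
      Set.range (h c) =
        Set.Ioo (-Real.log (c / (1 - c))) (Real.log (c / (1 - c))) :=
  ⟨strictMono_h hc, range_h hc⟩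
end

section
/- For every c ∈ [0, 1] and every f_i ∈ ℝ^{d_i}, the map f_j ↦ Q(1, f_i, f_j) is differentiable at f_j = 0 with gradient equal to (2(2c − 1)/σ_j²)·Q(1, f_i, 0)·(1 − Q(1, f_i, 0))·μ_j; in particular, if c ≠ 1/2 and μ_j ≠ 0 this gradient is nonzero, so the Bayes-optimal model for task i has nonzero weight on the task-j generative factor F_j. -/
open Real Filter

theorem hasGradientAt_phi_zero {d : ℕ} (y : ℝ) (μ : EuclideanSpace ℝ (Fin d)) (σ : ℝ) :
    HasGradientAt (fun f => phi f y μ σ) ((phi 0 y μ σ * y / σ ^ 2) • μ) 0 := by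
  rw [hasGradientAt_iff_hasFDerivAt]
  have h := ((((hasFDerivAt_id (𝕜 := ℝ) (0 : EuclideanSpace ℝ (Fin d))).sub_const
    (y • μ)).norm_sq.neg).mul_const (2 * σ ^ 2)⁻¹).exp
  refine h.congr_fderiv ?_
  ext v
  simp [phi, div_eq_mul_inv]
  ring

theorem phi_zero_neg {d : ℕ} (y : ℝ) (μ : EuclideanSpace ℝ (Fin d)) (σ : ℝ) :
    phi 0 (-y) μ σ = phi 0 y μ σ := by
  simp [phi]

theorem g_zero {di dj : ℕ} (μi : EuclideanSpace ℝ (Fin di))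
    (μj : EuclideanSpace ℝ (Fin dj)) (σi σj c y : ℝ) (fi : EuclideanSpace ℝ (Fin di)) :
    g μi μj σi σj c y fi 0 = 1 / 2 * phi fi y μi σi * phi 0 y μj σj := by
  rw [g, phi_zero_neg]
  ring

theorem hasGradientAt_g_zero {di dj : ℕ} (μi : EuclideanSpace ℝ (Fin di))
    (μj : EuclideanSpace ℝ (Fin dj)) (σi σj c y : ℝ) (fi : EuclideanSpace ℝ (Fin di)) :
    HasGradientAt (fun fj => g μi μj σi σj c y fi fj)
      ((g μi μj σi σj c y fi 0 * y * (2 * c - 1) / σj ^ 2) • μj) 0 := by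
  rw [hasGradientAt_iff_hasFDerivAt]
  have h := (((hasGradientAt_phi_zero y μj σj).hasFDerivAt.const_mul c).add
    ((hasGradientAt_phi_zero (-y) μj σj).hasFDerivAt.const_mul (1 - c))).const_mul
    (1 / 2 * phi fi y μi σi)
  refine h.congr_fderiv ?_
  ext v
  simp [g_zero, phi_zero_neg]
  ring

theorem g_zero_pos {di dj : ℕ} (μi : EuclideanSpace ℝ (Fin di))
    (μj : EuclideanSpace ℝ (Fin dj)) (σi σj c y : ℝ) (fi : EuclideanSpace ℝ (Fin di)) :
    0 < g μi μj σi σj c y fi 0 := by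
  have := phi_pos fi y μi σi
  have := phi_pos 0 y μj σj
  rw [g_zero]
  positivity

theorem stmt_16 {di dj : ℕ} (hdi : 1 ≤ di) (hdj : 1 ≤ dj)
    (μi : EuclideanSpace ℝ (Fin di)) (μj : EuclideanSpace ℝ (Fin dj))
    (σi σj : ℝ) (hσi : 0 < σi) (hσj : 0 < σj)
    (c : ℝ) (hc : c ∈ Set.Icc (0 : ℝ) 1)
    (fi : EuclideanSpace ℝ (Fin di)) :
    HasGradientAt (fun fj => Q μi μj σi σj c 1 fi fj)
        ((2 * (2 * c - 1) / σj ^ 2 * Q μi μj σi σj c 1 fi 0 *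
          (1 - Q μi μj σi σj c 1 fi 0)) • μj) 0 ∧
      (c ≠ 1 / 2 → μj ≠ 0 →
        (2 * (2 * c - 1) / σj ^ 2 * Q μi μj σi σj c 1 fi 0 *
          (1 - Q μi μj σi σj c 1 fi 0)) • μj ≠ 0) := by
  have hA := g_zero_pos μi μj σi σj c 1 fi
  have hB := g_zero_pos μi μj σi σj c (-1) fi
  have hAd := (hasGradientAt_g_zero μi μj σi σj c 1 fi).hasFDerivAt
  have hBd := (hasGradientAt_g_zero μi μj σi σj c (-1) fi).hasFDerivAt
  have hQ : 1 - Q μi μj σi σj c 1 fi 0 = g μi μj σi σj c (-1) fi 0 /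
      (g μi μj σi σj c 1 fi 0 + g μi μj σi σj c (-1) fi 0) := by
    rw [Q]
    field_simp
    ring
  rw [hQ]
  constructor
  · rw [hasGradientAt_iff_hasFDerivAt]
    have hne := (add_pos hA hB).ne'
    have h := hAd.mul ((hasDerivAt_inv hne).comp_hasFDerivAt
      (0 : EuclideanSpace ℝ (Fin dj)) (hAd.add hBd))
    refine (h.congr_fderiv ?_).congr_of_eventuallyEq
      (Eventually.of_forall fun fj => div_eq_mul_inv _ _)
    ext v
    simp [Q]
    field_simp
    ring
  · intro hc' hμ
    have hc2 : 2 * c - 1 ≠ 0 := fun h => hc' (by linarith)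
    refine smul_ne_zero ?_ hμ
    rw [Q]
    have := (add_pos hA hB).ne'
    have := hA.ne'
    have := hB.ne'
    have := hσj.ne'
    positivity
end
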